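/- Let 0 < α < 1 and let h_α(t) := Σ_{k=0}^∞ 2^{−kα} cos(2π·2^k t). Then there exists a constant c > 0 such that for every y ∈ (0,1), ( ∫_0^1 |h_α(t) − h_α(t − y)|² dt )^{1/2} ≥ c · min(|y|, 1 − |y|)^α. -/

import Mathlib

/-- The Weierstrass function `h_α(t) = Σ_{k≥0} 2^{−kα} cos(2π·2^k t)`. -/
noncomputable def weierstrass (α : ℝ) (t : ℝ) : ℝ :=
  ∑' k : ℕ, (2:ℝ) ^ (-(k:ℝ) * α) * Real.cos (2 * Real.pi * 2 ^ k * t)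

/-- A cosine of nonzero integer frequency has mean zero over a period. -/
theorem integral_cos_int_mul_sub_eq_zero {m : ℤ} (hm : m ≠ 0) (d : ℝ) :
    ∫ t in (0:ℝ)..1, Real.cos (2 * Real.pi * m * t - d) = 0 := by
  have hc : 2 * Real.pi * (m:ℝ) ≠ 0 := by
    have := Real.pi_pos.ne'
    have : (m:ℝ) ≠ 0 := by exact_mod_cast hm
    positivity
  rw [intervalIntegral.integral_comp_mul_sub (fun x => Real.cos x) hc, integral_cos]
  have h : Real.sin (2 * Real.pi * m * 1 - d) = Real.sin (2 * Real.pi * m * 0 - d) := by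
    rw [show 2 * Real.pi * (m:ℝ) * 1 - d = (2 * Real.pi * m * 0 - d) + m * (2 * Real.pi) by ring,
      Real.sin_add_int_mul_two_pi]
  rw [h, sub_self, smul_zero]

/-- Orthogonality over a period of translated sines with positive integer frequencies. -/
theorem integral_sin_mul_sin_nat {m n : ℕ} (hm : 0 < m) (z : ℝ) :
    ∫ t in (0:ℝ)..1, Real.sin (2 * Real.pi * m * (t - z)) * Real.sin (2 * Real.pi * n * (t - z)) =
      if m = n then 1 / 2 else 0 := by
  have key (t : ℝ) : Real.sin (2 * Real.pi * m * (t - z)) * Real.sin (2 * Real.pi * n * (t - z)) =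
      (1 / 2) * (Real.cos (2 * Real.pi * ((m - n : ℤ) : ℝ) * t - 2 * Real.pi * (m - n) * z) -
        Real.cos (2 * Real.pi * ((m + n : ℤ) : ℝ) * t - 2 * Real.pi * (m + n) * z)) := by
    push_cast
    rw [show 2 * Real.pi * ((m:ℝ) - n) * t - 2 * Real.pi * (m - n) * z =
        2 * Real.pi * m * (t - z) - 2 * Real.pi * n * (t - z) by ring,
      show 2 * Real.pi * ((m:ℝ) + n) * t - 2 * Real.pi * (m + n) * z =
        2 * Real.pi * m * (t - z) + 2 * Real.pi * n * (t - z) by ring,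
      Real.cos_sub, Real.cos_add]
    ring
  simp_rw [key]
  rw [intervalIntegral.integral_const_mul, intervalIntegral.integral_sub
    ((by fun_prop : Continuous _).intervalIntegrable _ _)
    ((by fun_prop : Continuous _).intervalIntegrable _ _),
    integral_cos_int_mul_sub_eq_zero (m := m + n) (by omega)]
  split_ifs with h
  · subst h
    simp
  · rw [integral_cos_int_mul_sub_eq_zero (by omega)]
    simp

theorem summable_two_rpow_neg_mul {α : ℝ} (hα : 0 < α) :
    Summable fun k : ℕ => (2:ℝ) ^ (-(k:ℝ) * α) := by
  have h : (fun k : ℕ => (2:ℝ) ^ (-(k:ℝ) * α)) = fun k : ℕ => ((2:ℝ) ^ (-α)) ^ k := by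
    ext k
    rw [← Real.rpow_natCast, ← Real.rpow_mul (by norm_num)]
    ring_nf
  rw [h]
  exact summable_geometric_of_lt_one (by positivity)
    (Real.rpow_lt_one_of_one_lt_of_neg (by norm_num) (by linarith))

theorem norm_two_rpow_mul_cos_le (α : ℝ) (k : ℕ) (t : ℝ) :
    ‖(2:ℝ) ^ (-(k:ℝ) * α) * Real.cos (2 * Real.pi * 2 ^ k * t)‖ ≤ (2:ℝ) ^ (-(k:ℝ) * α) := by
  rw [norm_mul, Real.norm_of_nonneg (by positivity)]
  exact mul_le_of_le_one_right (by positivity) (Real.abs_cos_le_one _)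

theorem continuous_weierstrass {α : ℝ} (hα : 0 < α) : Continuous (weierstrass α) :=
  continuous_tsum (fun _ => by fun_prop) (summable_two_rpow_neg_mul hα)
    (norm_two_rpow_mul_cos_le α)

/-- The sine series of an increment of the Weierstrass function. -/
theorem hasSum_weierstrass_sub {α : ℝ} (hα : 0 < α) (y t : ℝ) :
    HasSum (fun k : ℕ => -2 * (2:ℝ) ^ (-(k:ℝ) * α) * Real.sin (Real.pi * 2 ^ k * y) *
      Real.sin (2 * Real.pi * (2 ^ k : ℕ) * (t - y / 2)))
      (weierstrass α t - weierstrass α (t - y)) := by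
  have h (s : ℝ) : HasSum (fun k : ℕ => (2:ℝ) ^ (-(k:ℝ) * α) * Real.cos (2 * Real.pi * 2 ^ k * s))
      (weierstrass α s) :=
    ((summable_two_rpow_neg_mul hα).of_norm_bounded
      (fun k => norm_two_rpow_mul_cos_le α k s)).hasSum
  refine ((h t).sub (h (t - y))).congr_fun ?_
  intro k
  rw [← mul_sub, Real.cos_sub_cos]
  push_cast
  rw [show (2 * Real.pi * 2 ^ k * t + 2 * Real.pi * 2 ^ k * (t - y)) / 2 =
      2 * Real.pi * 2 ^ k * (t - y / 2) by ring,
    show (2 * Real.pi * 2 ^ k * t - 2 * Real.pi * 2 ^ k * (t - y)) / 2 =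
      Real.pi * 2 ^ k * y by ring]
  ring

/-- The sine coefficients of an increment of the Weierstrass function. -/
theorem integral_weierstrass_sub_mul_sin {α : ℝ} (hα : 0 < α) (y : ℝ) (k : ℕ) :
    ∫ t in (0:ℝ)..1, (weierstrass α t - weierstrass α (t - y)) *
      Real.sin (2 * Real.pi * (2 ^ k : ℕ) * (t - y / 2)) =
      -(2:ℝ) ^ (-(k:ℝ) * α) * Real.sin (Real.pi * 2 ^ k * y) := by
  set a : ℕ → ℝ := fun j => -2 * (2:ℝ) ^ (-(j:ℝ) * α) * Real.sin (Real.pi * 2 ^ j * y) with ha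
  set g : ℕ → ℝ → ℝ := fun j t => Real.sin (2 * Real.pi * (2 ^ j : ℕ) * (t - y / 2)) with hg
  have hg1 (j : ℕ) (t : ℝ) : |g j t| ≤ 1 := Real.abs_sin_le_one _
  have hab (j : ℕ) : |a j| ≤ 2 * (2:ℝ) ^ (-(j:ℝ) * α) := by
    simp only [ha, abs_mul, abs_neg, abs_two]
    rw [abs_of_nonneg (by positivity : (0:ℝ) ≤ (2:ℝ) ^ (-(j:ℝ) * α))]
    exact mul_le_of_le_one_right (by positivity) (Real.abs_sin_le_one _)
  have hsum : HasSum (fun j => ∫ t in (0:ℝ)..1, a j * g j t * g k t)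
      (∫ t in (0:ℝ)..1, (weierstrass α t - weierstrass α (t - y)) * g k t) := by
    refine intervalIntegral.hasSum_integral_of_dominated_convergence
      (fun j _ => 2 * (2:ℝ) ^ (-(j:ℝ) * α))
      (fun j => (by fun_prop : Continuous _).aestronglyMeasurable)
      (fun j => .of_forall fun t _ => ?_)
      (.of_forall fun t _ => (summable_two_rpow_neg_mul hα).mul_left 2)
      (by simp)
      (.of_forall fun t _ => (hasSum_weierstrass_sub hα y t).mul_right _)
    rw [norm_mul, norm_mul]
    calc |a j| * |g j t| * |g k t| ≤ |a j| * 1 * 1 := by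
          gcongr
          · exact hg1 j t
          · exact hg1 k t
      _ ≤ _ := by simpa using hab j
  have hint (j : ℕ) : ∫ t in (0:ℝ)..1, a j * g j t * g k t = if j = k then a k / 2 else 0 := by
    simp_rw [mul_assoc]
    rw [intervalIntegral.integral_const_mul, integral_sin_mul_sin_nat (by positivity)]
    by_cases h : j = k
    · subst h; simp; ring
    · simp [h]
  simp_rw [hint] at hsum
  rw [hsum.unique (hasSum_ite_eq k (a k / 2))]
  simp only [ha]
  ring

/-- Bessel's inequality for one frequency of an increment of the Weierstrass function. -/
theorem le_integral_sq_weierstrass_sub {α : ℝ} (hα : 0 < α) (y : ℝ) (k : ℕ) :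
    2 * ((2:ℝ) ^ (-(k:ℝ) * α)) ^ 2 * Real.sin (Real.pi * 2 ^ k * y) ^ 2 ≤
      ∫ t in (0:ℝ)..1, (weierstrass α t - weierstrass α (t - y)) ^ 2 := by
  have hw := continuous_weierstrass hα
  have hfg := integral_weierstrass_sub_mul_sin hα y k
  have hgg := integral_sin_mul_sin_nat (m := 2 ^ k) (n := 2 ^ k) (by positivity) (y / 2)
  rw [if_pos rfl] at hgg
  set f : ℝ → ℝ := fun t => weierstrass α t - weierstrass α (t - y) with hf
  set g : ℝ → ℝ := fun t => Real.sin (2 * Real.pi * (2 ^ k : ℕ) * (t - y / 2)) with hg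
  have hfc : Continuous f := by fun_prop
  have hgc : Continuous g := by fun_prop
  set b := -(2:ℝ) ^ (-(k:ℝ) * α) * Real.sin (Real.pi * 2 ^ k * y) with hb
  have hexp : ∫ t in (0:ℝ)..1, (f t - 2 * b * g t) ^ 2 =
      (∫ t in (0:ℝ)..1, f t ^ 2) - 4 * b * (∫ t in (0:ℝ)..1, f t * g t) +
        4 * b ^ 2 * ∫ t in (0:ℝ)..1, g t * g t := by
    rw [← intervalIntegral.integral_const_mul, ← intervalIntegral.integral_const_mul,
      ← intervalIntegral.integral_sub ((by fun_prop : Continuous _).intervalIntegrable _ _)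
        ((by fun_prop : Continuous _).intervalIntegrable _ _),
      ← intervalIntegral.integral_add ((by fun_prop : Continuous _).intervalIntegrable _ _)
        ((by fun_prop : Continuous _).intervalIntegrable _ _)]
    congr 1
    ext t
    ring
  have hnn : 0 ≤ ∫ t in (0:ℝ)..1, (f t - 2 * b * g t) ^ 2 :=
    intervalIntegral.integral_nonneg zero_le_one fun t _ => sq_nonneg _
  rw [hexp, hfg, hgg] at hnn
  have hb2 : b ^ 2 = ((2:ℝ) ^ (-(k:ℝ) * α)) ^ 2 * Real.sin (Real.pi * 2 ^ k * y) ^ 2 := by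
    rw [hb]; ring
  change _ ≤ ∫ t in (0:ℝ)..1, f t ^ 2
  nlinarith

theorem exists_two_pow_mul_mem_Ioc {δ : ℝ} (h0 : 0 < δ) (h1 : δ ≤ 1 / 2) :
    ∃ k : ℕ, 2 ^ k * δ ∈ Set.Ioc (1 / 4 : ℝ) (1 / 2) := by
  obtain ⟨k, hk, hk'⟩ := exists_nat_pow_near (x := 1 / (2 * δ)) (y := (2:ℝ))
    (by rw [le_div_iff₀ (by positivity)]; linarith) one_lt_two
  rw [le_div_iff₀ (by positivity)] at hk
  rw [div_lt_iff₀ (by positivity), pow_succ] at hk'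
  exact ⟨k, by linarith, by linarith⟩

theorem half_le_sin_pi_mul_sq {x : ℝ} (hx : x ∈ Set.Icc (1 / 4 : ℝ) (1 / 2)) :
    1 / 2 ≤ Real.sin (Real.pi * x) ^ 2 := by
  have hpi := Real.pi_pos
  have hcos : Real.cos (2 * (Real.pi * x)) ≤ 0 :=
    Real.cos_nonpos_of_pi_div_two_le_of_le (by nlinarith [hx.1]) (by nlinarith [hx.2])
  rw [Real.sin_sq_eq_half_sub]
  linarith

theorem sin_pi_mul_nat_mul_one_sub_sq (n : ℕ) (y : ℝ) :
    Real.sin (Real.pi * n * (1 - y)) ^ 2 = Real.sin (Real.pi * n * y) ^ 2 := by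
  rw [show Real.pi * n * (1 - y) = n * Real.pi - Real.pi * n * y by ring, Real.sin_nat_mul_pi_sub]
  rw [neg_sq, mul_pow, ← pow_mul, mul_comm n 2, pow_mul]
  norm_num

/-- L² lower bound for increments of the Weierstrass function:
`‖h_α(·) − h_α(· − y)‖_{L²[0,1]} ≥ c ⟨y⟩^α` where `⟨y⟩ = min(|y|, 1−|y|)`. -/
theorem weierstrass_L2_lower_bound (α : ℝ) (hα0 : 0 < α) (hα1 : α < 1) :
    ∃ c : ℝ, 0 < c ∧ ∀ y ∈ Set.Ioo (0:ℝ) 1,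
      c * (min |y| (1 - |y|)) ^ α ≤
        Real.sqrt (∫ t in (0:ℝ)..1, (weierstrass α t - weierstrass α (t - y)) ^ 2) := by
  refine ⟨1, one_pos, fun y hy => ?_⟩
  rw [abs_of_pos hy.1, one_mul]
  set δ := min y (1 - y) with hδ
  have hδ0 : 0 < δ := lt_min hy.1 (by linarith [hy.2])
  have hδ1 : δ ≤ 1 / 2 := by
    have := min_le_left y (1 - y)
    have := min_le_right y (1 - y)
    linarith
  obtain ⟨k, hk⟩ := exists_two_pow_mul_mem_Ioc hδ0 hδ1
  have hsin : 1 / 2 ≤ Real.sin (Real.pi * 2 ^ k * y) ^ 2 := by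
    have h : Real.sin (Real.pi * 2 ^ k * δ) ^ 2 = Real.sin (Real.pi * 2 ^ k * y) ^ 2 := by
      rcases min_choice y (1 - y) with h | h
      · rw [hδ, h]
      · rw [hδ, h]
        exact_mod_cast sin_pi_mul_nat_mul_one_sub_sq (2 ^ k) y
    rw [← h, mul_assoc]
    exact half_le_sin_pi_mul_sq ⟨hk.1.le, hk.2⟩
  have hcoef : δ ^ α ≤ (2:ℝ) ^ (-(k:ℝ) * α) := by
    rw [Real.rpow_mul two_pos.le, Real.rpow_neg two_pos.le, Real.rpow_natCast]
    refine Real.rpow_le_rpow hδ0.le ?_ hα0.le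
    rw [← one_div, le_div_iff₀ (by positivity)]
    linarith [hk.2]
  refine Real.le_sqrt_of_sq_le (le_trans ?_ (le_integral_sq_weierstrass_sub hα0 y k))
  calc (δ ^ α) ^ 2 ≤ ((2:ℝ) ^ (-(k:ℝ) * α)) ^ 2 := by gcongr
    _ = 2 * ((2:ℝ) ^ (-(k:ℝ) * α)) ^ 2 * (1 / 2) := by ring
    _ ≤ _ := by gcongr
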